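/- Let n ≥ 2 and let A and B be n×n complex matrices that are Hermitian and positive definite. Then tr(B⁻¹A) ≤ (1/n^{n−2}) · (tr(A⁻¹B))^{n−1} · det(A)/det(B). -/

import Mathlib

open scoped ComplexOrder

/-- The AM-GM inequality together with Maclaurin's inequality between the elementary symmetric
polynomials of degrees `card s - 1` and `1`. -/
theorem prod_le_and_prod_mul_sum_inv_le {ι : Type*} (x : ι → ℝ) (s : Finset ι)
    (hs : s.Nonempty) (hx : ∀ i ∈ s, 0 < x i) :
    ∏ i ∈ s, x i ≤ ((∑ i ∈ s, x i) / s.card) ^ s.card ∧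
      (∏ i ∈ s, x i) * ∑ i ∈ s, (x i)⁻¹
        ≤ s.card * ((∑ i ∈ s, x i) / s.card) ^ (s.card - 1) := by
  induction hs using Finset.Nonempty.cons_induction with
  | singleton a =>
    have := hx a (by simp)
    simp [this.ne']
  | cons a s has hs ih =>
    obtain ⟨amgm, maclaurin⟩ := ih fun i hi => hx i (Finset.mem_cons_of_mem hi)
    have hy : 0 < x a := hx a (Finset.mem_cons_self a s)
    have hsum : 0 < ∑ i ∈ s, x i :=
      Finset.sum_pos (fun i hi => hx i (Finset.mem_cons_of_mem hi)) hs
    obtain ⟨k, hk⟩ : ∃ k, s.card = k + 1 := ⟨s.card - 1, by have := hs.card_pos; omega⟩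
    simp only [Finset.prod_cons, Finset.sum_cons, Finset.card_cons, hk, Nat.add_sub_cancel,
      Nat.cast_add, Nat.cast_one] at amgm maclaurin ⊢
    set P := ∏ i ∈ s, x i
    set R := ∑ i ∈ s, (x i)⁻¹
    set y := x a
    obtain ⟨m, hm⟩ : ∃ m, (∑ i ∈ s, x i) / (k + 1 : ℝ) = m := ⟨_, rfl⟩
    have hS : ∑ i ∈ s, x i = (k + 1) * m := by rw [← hm]; field_simp
    have hm0 : 0 < m := by rw [← hm]; positivity
    rw [hm] at amgm maclaurin
    rw [hS]
    obtain ⟨d, hd⟩ : ∃ d, (y + (k + 1) * m) / (k + 1 + 1) = m + d :=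
      ⟨(y + (k + 1) * m) / (k + 1 + 1) - m, by ring⟩
    have hyd : y = m + (k + 2) * d := by
      rw [div_eq_iff (by positivity)] at hd
      linarith
    have hmd : 0 ≤ m + d := by rw [← hd]; positivity
    have bernoulli (n : ℕ) := pow_add_mul_le_add_pow hm0.le (by linarith : 0 ≤ 2 * m + d) n
    have b₁ := bernoulli (k + 1)
    have b₂ := bernoulli (k + 2)
    rw [hd]
    simp only [Nat.add_sub_cancel, Nat.cast_add, Nat.cast_one, Nat.cast_ofNat] at b₁ b₂
    constructor
    · calc y * P ≤ y * m ^ (k + 1) := by gcongr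
        _ = m ^ (k + 2) + (k + 2) * m ^ (k + 1) * d := by rw [hyd]; ring
        _ ≤ (m + d) ^ (k + 2) := b₂
    · calc y * P * (y⁻¹ + R) = P + y * (P * R) := by field_simp
        _ ≤ m ^ (k + 1) + y * ((k + 1) * m ^ k) := by gcongr
        _ = (k + 2) * (m ^ (k + 1) + (k + 1) * m ^ k * d) := by rw [hyd]; ring
        _ ≤ (k + 2) * (m + d) ^ (k + 1) := by gcongr
        _ = (k + 1 + 1) * (m + d) ^ (k + 1) := by ring

namespace Matrix

theorem PosDef.exists_isUnit_conjTranspose_mul_self {n : Type*} [Fintype n] [DecidableEq n]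
    {A : Matrix n n ℂ} (hA : A.PosDef) : ∃ D : Matrix n n ℂ, IsUnit D ∧ A = Dᴴ * D := by
  open scoped MatrixOrder Matrix.Norms.L2Operator in
  exact CStarAlgebra.isStrictlyPositive_iff_eq_star_mul_self.mp hA.isStrictlyPositive

theorem PosDef.trace_inv_eq_sum_inv_eigenvalues {n : Type*} [Fintype n] [DecidableEq n]
    {C : Matrix n n ℂ} (hC : C.PosDef) :
    C⁻¹.trace = ∑ i, ((hC.isHermitian.eigenvalues i : ℂ))⁻¹ := by
  set U := hC.isHermitian.eigenvectorUnitary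
  set d : n → ℂ := fun i => hC.isHermitian.eigenvalues i
  have hd (i : n) : d i ≠ 0 := Complex.ofReal_ne_zero.mpr (hC.eigenvalues_pos i).ne'
  have hinv : C⁻¹ = Unitary.conjStarAlgAut ℂ _ U (diagonal fun i => (d i)⁻¹) := by
    refine inv_eq_right_inv ?_
    conv_lhs => enter [1]; rw [hC.isHermitian.spectral_theorem]
    rw [← map_mul, diagonal_mul_diagonal]
    convert map_one (Unitary.conjStarAlgAut ℂ _ U)
    rw [← diagonal_one]
    congr 1
    ext i
    exact mul_inv_cancel₀ (hd i)
  rw [hinv, Unitary.conjStarAlgAut_apply, trace_mul_cycle, Unitary.coe_star_mul_self, one_mul,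
    trace_diagonal]

/-- Maclaurin's inequality for the eigenvalues of a positive definite matrix. -/
theorem PosDef.trace_inv_re_le {n : Type*} [Fintype n] [DecidableEq n] [Nonempty n]
    {C : Matrix n n ℂ} (hC : C.PosDef) :
    C⁻¹.trace.re ≤ Fintype.card n * (C.trace.re / Fintype.card n) ^ (Fintype.card n - 1)
      / C.det.re := by
  have hpos := hC.eigenvalues_pos
  have htrace : C.trace.re = ∑ i, hC.isHermitian.eigenvalues i := by
    simp [hC.isHermitian.trace_eq_sum_eigenvalues]
  have hdet : C.det.re = ∏ i, hC.isHermitian.eigenvalues i := by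
    rw [hC.isHermitian.det_eq_prod_eigenvalues]
    exact (congrArg Complex.re (Complex.ofReal_prod _ _)).symm
  have hinv : C⁻¹.trace.re = ∑ i, (hC.isHermitian.eigenvalues i)⁻¹ := by
    rw [hC.trace_inv_eq_sum_inv_eigenvalues]
    simp only [← Complex.ofReal_inv, ← Complex.ofReal_sum, Complex.ofReal_re]
  rw [htrace, hdet, hinv, le_div_iff₀ (Finset.prod_pos fun i _ => hpos i), mul_comm]
  exact (prod_le_and_prod_mul_sum_inv_le _ Finset.univ Finset.univ_nonempty fun i _ => hpos i).2

end Matrix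

/-- For `n ≥ 2` and Hermitian positive definite `n×n` complex matrices `A`, `B`:
`tr(B⁻¹A) ≤ (1/n^{n-2}) (tr(A⁻¹B))^{n-1} det A / det B`. -/
theorem trace_inv_mul_le (n : ℕ) (hn : 2 ≤ n)
    (A B : Matrix (Fin n) (Fin n) ℂ) (hA : A.PosDef) (hB : B.PosDef) :
    (Matrix.trace (B⁻¹ * A)).re
      ≤ (1 / (n : ℝ) ^ (n - 2)) * ((Matrix.trace (A⁻¹ * B)).re) ^ (n - 1)
          * (A.det.re / B.det.re) := by
  have : Nonempty (Fin n) := ⟨⟨0, by omega⟩⟩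
  obtain ⟨D, hD, hAD⟩ := hA.exists_isUnit_conjTranspose_mul_self
  have hDdet : IsUnit D.det := (Matrix.isUnit_iff_isUnit_det D).mp hD
  have hDinv : IsUnit D⁻¹ := Matrix.isUnit_nonsing_inv_iff.mpr hD
  set C := (D⁻¹).conjTranspose * B * D⁻¹ with hCdef
  have hC : C.PosDef :=
    hB.conjTranspose_mul_mul_same (Matrix.mulVec_injective_of_isUnit hDinv)
  have htrace : (A⁻¹ * B).trace = C.trace := by
    rw [hAD, Matrix.mul_inv_rev, hCdef, Matrix.trace_mul_comm _ D⁻¹,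
      Matrix.conjTranspose_nonsing_inv, Matrix.mul_assoc]
  have hinv : (B⁻¹ * A).trace = C⁻¹.trace := by
    rw [hCdef, Matrix.mul_inv_rev, Matrix.mul_inv_rev, Matrix.conjTranspose_nonsing_inv,
      Matrix.nonsing_inv_nonsing_inv _ hDdet,
      Matrix.nonsing_inv_nonsing_inv _ (by simpa [Matrix.det_conjTranspose] using hDdet),
      Matrix.trace_mul_comm D, Matrix.mul_assoc, ← hAD]
  have hdet : C.det * A.det = B.det := by
    have h₁ : D⁻¹.det * D.det = 1 := by
      rw [← Matrix.det_mul, Matrix.nonsing_inv_mul _ hDdet, Matrix.det_one]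
    have h₂ : star D⁻¹.det * star D.det = 1 := by rw [← star_mul', h₁, star_one]
    rw [hAD, hCdef]
    simp only [Matrix.det_mul, Matrix.det_conjTranspose]
    linear_combination B.det * (D⁻¹.det * D.det * h₂ + h₁)
  obtain ⟨hA_pos, hA_im⟩ := Complex.pos_iff.mp hA.det_pos
  have hC_pos := (Complex.pos_iff.mp hC.det_pos).1
  have hdet_re : B.det.re = C.det.re * A.det.re := by
    rw [← hdet, Complex.mul_re, ← hA_im]
    ring
  have hmain := hC.trace_inv_re_le
  rw [Fintype.card_fin] at hmain
  rw [hinv, htrace, hdet_re]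
  refine hmain.trans_eq ?_
  obtain ⟨k, rfl⟩ := Nat.exists_eq_add_of_le' hn
  rw [div_pow, Nat.add_sub_cancel, show k + 2 - 1 = k + 1 by omega]
  field_simp
  ring
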